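/- arXiv:1810.06191 — 6 statements merged into one kernel-verified Lean document; each statement's English description precedes it below -/
import Mathlib

section
/- Let ρ be a probability density on ℝ^d, let g : ℝ^d → [0,∞) and, for each δ > 0, g_δ : ℝ^d → [0,∞) be measurable, and suppose Z := ∫g(u)ρ(u)du > 0. Assume there exist δ⁺ > 0 and constants K₁, K₂ < ∞ and a measurable φ : ℝ^d → [0,∞) with ∫φ(u)²ρ(u)du ≤ K₁ such that, for all δ ∈ (0,δ⁺): |√(g(u)) − √(g_δ(u))| ≤ φ(u)·δ for all u, and sup_{u∈ℝ^d}(√(g(u)) + √(g_δ(u))) ≤ K₂. Define the posterior densities π(u) = g(u)ρ(u)/Z and π_δ(u) = g_δ(u)ρ(u)/Z_δ with Z_δ = ∫g_δ(u)ρ(u)du. Then there exist δ̃⁺ > 0 and c ∈ (0,∞) independent of δ such that d_H(π,π_δ) ≤ c·δ for all δ ∈ (0,δ̃⁺). -/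
open MeasureTheory

lemma aux_inv_sqrt (Z W E : ℝ) (hZ : 0 < Z) (hW : Z / 2 ≤ W) (hE : |Z - W| ≤ E) :
    (1 / Real.sqrt Z - 1 / Real.sqrt W) ^ 2 ≤ 2 * E ^ 2 / Z ^ 3 := by
  have hW0 : 0 < W := by linarith
  have hs : 0 < Real.sqrt Z := Real.sqrt_pos.2 hZ
  have ht : 0 < Real.sqrt W := Real.sqrt_pos.2 hW0
  have hs2 : Real.sqrt Z ^ 2 = Z := Real.sq_sqrt hZ.le
  have ht2 : Real.sqrt W ^ 2 = W := Real.sq_sqrt hW0.le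
  have hE2 : (Z - W) ^ 2 ≤ E ^ 2 := by
    rw [← sq_abs (Z - W)]
    exact pow_le_pow_left₀ (abs_nonneg _) hE 2
  generalize Real.sqrt Z = s at *
  generalize Real.sqrt W = t at *
  have h1 : (t - s) ^ 2 * Z ≤ E ^ 2 := by
    have : (Z - W) ^ 2 = (t - s) ^ 2 * (s + t) ^ 2 := by rw [← hs2, ← ht2]; ring
    have h3 : Z ≤ (s + t) ^ 2 := by nlinarith [mul_pos hs ht]
    calc (t - s) ^ 2 * Z ≤ (t - s) ^ 2 * (s + t) ^ 2 := by gcongr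
      _ ≤ E ^ 2 := by rw [← this]; exact hE2
  have h2 : (1 / s - 1 / t) ^ 2 = (t - s) ^ 2 / (Z * W) := by
    rw [← hs2, ← ht2]; field_simp
  rw [h2, div_le_div_iff₀ (by positivity) (by positivity)]
  calc (t - s) ^ 2 * Z ^ 3 = ((t - s) ^ 2 * Z) * (Z * Z) := by ring
    _ ≤ E ^ 2 * (Z * (2 * W)) := by gcongr; linarith
    _ = 2 * E ^ 2 * (Z * W) := by ring

lemma aux_pt (a b r s t p K q : ℝ) (hr : 0 ≤ r) (hs : 0 < s) (hb : 0 ≤ b)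
    (hab : |a - b| ≤ p) (hbK : b ≤ K) (hq : (1 / s - 1 / t) ^ 2 ≤ q) :
    (a * r / s - b * r / t) ^ 2 ≤ 2 * (p ^ 2 * r ^ 2 / s ^ 2 + K ^ 2 * q * r ^ 2) := by
  have e : a * r / s - b * r / t = (a - b) * r / s + b * (1 / s - 1 / t) * r := by ring
  have h1 : ((a - b) * r / s) ^ 2 ≤ p ^ 2 * r ^ 2 / s ^ 2 := by
    rw [div_pow, mul_pow, ← sq_abs (a - b)]
    gcongr
  have h2 : (b * (1 / s - 1 / t) * r) ^ 2 ≤ K ^ 2 * q * r ^ 2 := by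
    rw [mul_pow, mul_pow]
    gcongr
  rw [e]
  nlinarith [sq_nonneg ((a - b) * r / s - b * (1 / s - 1 / t) * r)]

/-- Well-posedness of the posterior: under the approximation assumptions on
the likelihoods `g, g_δ`, the posteriors `π = gρ/Z` and `π_δ = g_δρ/Z_δ` satisfy
`d_H(π, π_δ) ≤ c·δ` for all `δ ∈ (0, δ̃⁺)`, for some `δ̃⁺ > 0` and `c ∈ (0,∞)`
independent of `δ`. -/
theorem stmt_5 (d : ℕ) (ρ : (Fin d → ℝ) → ℝ)
    (hρm : Measurable ρ) (hρ0 : ∀ u, 0 ≤ ρ u)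
    (hρi : Integrable ρ) (hρ1 : ∫ u, ρ u = 1)
    (g : (Fin d → ℝ) → ℝ) (gδ : ℝ → (Fin d → ℝ) → ℝ)
    (hgm : Measurable g) (hgδm : ∀ δ, Measurable (gδ δ))
    (hg0 : ∀ u, 0 ≤ g u) (hgδ0 : ∀ δ u, 0 ≤ gδ δ u)
    (hZ : 0 < ∫ u, g u * ρ u)
    (δplus : ℝ) (hδplus : 0 < δplus)
    (K₁ K₂ : ℝ) (φ : (Fin d → ℝ) → ℝ)
    (hφm : Measurable φ) (hφ0 : ∀ u, 0 ≤ φ u)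
    (hφK₁ : ∫ u, φ u ^ 2 * ρ u ≤ K₁)
    (hφi : Integrable (fun u => φ u ^ 2 * ρ u))
    (h1 : ∀ δ ∈ Set.Ioo (0 : ℝ) δplus, ∀ u,
      |Real.sqrt (g u) - Real.sqrt (gδ δ u)| ≤ φ u * δ)
    (h2 : ∀ δ ∈ Set.Ioo (0 : ℝ) δplus, ∀ u,
      Real.sqrt (g u) + Real.sqrt (gδ δ u) ≤ K₂) :
    ∃ δtplus > (0 : ℝ), ∃ c > (0 : ℝ), ∀ δ ∈ Set.Ioo (0 : ℝ) δtplus,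
      Real.sqrt ((1 / 2) * ∫ u,
        (Real.sqrt (g u * ρ u / ∫ v, g v * ρ v) -
          Real.sqrt (gδ δ u * ρ u / ∫ v, gδ δ v * ρ v)) ^ 2) ≤ c * δ := by
  obtain ⟨Z, hZdef⟩ : ∃ Z, Z = ∫ u, g u * ρ u := ⟨_, rfl⟩
  rw [← hZdef] at hZ ⊢
  have hK₁ : 0 ≤ K₁ := le_trans
    (integral_nonneg fun u => mul_nonneg (sq_nonneg _) (hρ0 u)) hφK₁
  have hK₂ : 0 ≤ K₂ := le_trans
    (add_nonneg (Real.sqrt_nonneg _) (Real.sqrt_nonneg _))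
    (h2 (δplus / 2) ⟨by linarith, by linarith⟩ 0)
  have bdd : ∀ f : (Fin d → ℝ) → ℝ, Measurable f → (∀ u, 0 ≤ f u) →
      (∀ u, Real.sqrt (f u) ≤ K₂) → Integrable (fun u => f u * ρ u) := by
    intro f hf hf0 hfK
    refine hρi.bdd_mul (c := K₂ ^ 2) hf.aestronglyMeasurable (Filter.Eventually.of_forall fun u => ?_)
    rw [Real.norm_of_nonneg (hf0 u), ← Real.sq_sqrt (hf0 u)]
    exact pow_le_pow_left₀ (Real.sqrt_nonneg _) (hfK u) 2
  have hgi : Integrable (fun u => g u * ρ u) := bdd g hgm hg0 fun u => by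
    have := h2 (δplus / 2) ⟨by linarith, by linarith⟩ u
    linarith [Real.sqrt_nonneg (gδ (δplus / 2) u)]
  set M := K₂ * (1 + K₁) with hM
  have hM0 : 0 ≤ M := by positivity
  set C := K₁ / Z + K₂ ^ 2 * (2 * M ^ 2 / Z ^ 3) with hC
  have hC0 : 0 ≤ C := by positivity
  refine ⟨min δplus (Z / (2 * (M + 1))), lt_min hδplus (by positivity),
    Real.sqrt C + 1, by positivity, ?_⟩
  rintro δ ⟨hδ0, hδ⟩
  have hδm : δ ∈ Set.Ioo (0 : ℝ) δplus := ⟨hδ0, hδ.trans_le (min_le_left _ _)⟩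
  have hδ2 : δ < Z / (2 * (M + 1)) := hδ.trans_le (min_le_right _ _)
  have hbK : ∀ u, Real.sqrt (gδ δ u) ≤ K₂ := fun u => by
    linarith [h2 δ hδm u, Real.sqrt_nonneg (g u)]
  have hgδi := bdd (gδ δ) (hgδm δ) (hgδ0 δ) hbK
  obtain ⟨W, hWdef⟩ : ∃ W, W = ∫ u, gδ δ u * ρ u := ⟨_, rfl⟩
  rw [← hWdef]
  have hE : |Z - W| ≤ M * δ := by
    rw [hZdef, hWdef, ← integral_sub hgi hgδi]
    have hi : Integrable (fun u => K₂ * δ * (ρ u + φ u ^ 2 * ρ u)) :=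
      (hρi.add hφi).const_mul _
    have hle := norm_integral_le_of_norm_le
      (f := fun u => g u * ρ u - gδ δ u * ρ u) hi (Filter.Eventually.of_forall fun u => by
        have e : g u * ρ u - gδ δ u * ρ u = (Real.sqrt (g u) - Real.sqrt (gδ δ u)) *
            (Real.sqrt (g u) + Real.sqrt (gδ δ u)) * ρ u := by
          have e1 := Real.sq_sqrt (hg0 u)
          have e2 := Real.sq_sqrt (hgδ0 δ u)
          linear_combination (-ρ u) * e1 + ρ u * e2
        have hn : 0 ≤ Real.sqrt (g u) + Real.sqrt (gδ δ u) := by positivity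
        have hφ1 : φ u ≤ 1 + φ u ^ 2 := by nlinarith [sq_nonneg (φ u - 1), sq_nonneg (φ u)]
        rw [e, Real.norm_eq_abs, abs_mul, abs_mul, abs_of_nonneg hn, abs_of_nonneg (hρ0 u)]
        have hr := hρ0 u
        have hp := hφ0 u
        calc _ ≤ (φ u * δ) * K₂ * ρ u := by
              gcongr
              · exact h1 δ hδm u
              · exact h2 δ hδm u
          _ ≤ ((1 + φ u ^ 2) * δ) * K₂ * ρ u := by gcongr
          _ = _ := by ring)
    rw [integral_const_mul, integral_add hρi hφi, hρ1] at hle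
    refine hle.trans ?_
    rw [hM]
    calc K₂ * δ * (1 + ∫ u, φ u ^ 2 * ρ u) ≤ K₂ * δ * (1 + K₁) := by gcongr
      _ = _ := by ring
  have hW : Z / 2 ≤ W := by
    rw [lt_div_iff₀ (by positivity)] at hδ2
    have := (abs_le.1 hE).2
    nlinarith
  have hq := aux_inv_sqrt Z W (M * δ) hZ hW hE
  have hZs : Real.sqrt Z ^ 2 = Z := Real.sq_sqrt hZ.le
  have hi2 : Integrable (fun u => 2 * (δ ^ 2 / Z * (φ u ^ 2 * ρ u) +
      K₂ ^ 2 * (2 * (M * δ) ^ 2 / Z ^ 3) * ρ u)) :=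
    ((hφi.const_mul _).add (hρi.const_mul _)).const_mul _
  have key : (∫ u, (Real.sqrt (g u * ρ u / Z) - Real.sqrt (gδ δ u * ρ u / W)) ^ 2) ≤
      2 * (C * δ ^ 2) := by
    refine (integral_mono_of_nonneg (Filter.Eventually.of_forall fun u => sq_nonneg _) hi2
      (Filter.Eventually.of_forall fun u => ?_)).trans ?_
    · have h := aux_pt (Real.sqrt (g u)) (Real.sqrt (gδ δ u)) (Real.sqrt (ρ u)) (Real.sqrt Z)
        (Real.sqrt W) (φ u * δ) K₂ _ (Real.sqrt_nonneg _) (Real.sqrt_pos.2 hZ)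
        (Real.sqrt_nonneg _) (h1 δ hδm u) (hbK u) hq
      rw [hZs, Real.sq_sqrt (hρ0 u)] at h
      simp only
      rw [Real.sqrt_div (mul_nonneg (hg0 u) (hρ0 u)), Real.sqrt_mul (hg0 u),
        Real.sqrt_div (mul_nonneg (hgδ0 δ u) (hρ0 u)), Real.sqrt_mul (hgδ0 δ u)]
      refine h.trans (le_of_eq ?_)
      ring
    · rw [integral_const_mul, integral_add (hφi.const_mul _) (hρi.const_mul _),
        integral_const_mul, integral_const_mul, hρ1]
      calc _ ≤ 2 * (δ ^ 2 / Z * K₁ + K₂ ^ 2 * (2 * (M * δ) ^ 2 / Z ^ 3) * 1) := by gcongr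
        _ = _ := by rw [hC]; ring
  have hCs := Real.sqrt_nonneg C
  calc _ ≤ Real.sqrt (C * δ ^ 2) := Real.sqrt_le_sqrt (by linarith)
    _ = Real.sqrt C * δ := by rw [Real.sqrt_mul hC0, Real.sqrt_sq hδ0.le]
    _ ≤ _ := by nlinarith
end

section
/- Let A ∈ ℝ^{k×d} with trivial null space, let Γ₀ ∈ ℝ^{k×k} and Ĉ ∈ ℝ^{d×d} be symmetric positive definite, and let y ∈ ℝ^k, m̂ ∈ ℝ^d. For γ > 0 define m(γ) = (AᵀΓ₀⁻¹A + γ²Ĉ⁻¹)⁻¹(AᵀΓ₀⁻¹y + γ²Ĉ⁻¹m̂) and C(γ) = γ²(AᵀΓ₀⁻¹A + γ²Ĉ⁻¹)⁻¹. Then AᵀΓ₀⁻¹A is symmetric positive definite (hence invertible), and as γ → 0⁺ one has C(γ) → 0 and m(γ) → m⁺ := (AᵀΓ₀⁻¹A)⁻¹AᵀΓ₀⁻¹y, where m⁺ is the unique minimizer over u ∈ ℝ^d of the least-squares functional |Γ₀^{-1/2}(y − Au)|². -/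
open Matrix Filter Topology

/-- small noise limit of the posterior in the overdetermined case.
With `Null(A) = {0}`, `AᵀΓ₀⁻¹A` is positive definite; as `γ → 0⁺` the posterior
covariance `C(γ) = γ²(AᵀΓ₀⁻¹A + γ²Ĉ⁻¹)⁻¹` tends to `0`, the posterior mean
`m(γ) = (AᵀΓ₀⁻¹A + γ²Ĉ⁻¹)⁻¹(AᵀΓ₀⁻¹y + γ²Ĉ⁻¹m̂)` tends to
`m⁺ = (AᵀΓ₀⁻¹A)⁻¹AᵀΓ₀⁻¹y`, and `m⁺` is the unique minimizer of
`u ↦ |Γ₀^{-1/2}(y − Au)|² = ⟨y−Au, Γ₀⁻¹(y−Au)⟩`. -/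
theorem stmt_8 (d k : ℕ) (A : Matrix (Fin k) (Fin d) ℝ)
    (hA : ∀ u : Fin d → ℝ, A.mulVec u = 0 → u = 0)
    (Γ₀ : Matrix (Fin k) (Fin k) ℝ) (hΓ₀ : Γ₀.PosDef)
    (Chat : Matrix (Fin d) (Fin d) ℝ) (hChat : Chat.PosDef)
    (y : Fin k → ℝ) (mhat : Fin d → ℝ) :
    (Aᵀ * Γ₀⁻¹ * A).PosDef ∧
    Tendsto (fun γ : ℝ => γ ^ 2 • (Aᵀ * Γ₀⁻¹ * A + γ ^ 2 • Chat⁻¹)⁻¹)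
      (𝓝[>] 0) (𝓝 (0 : Matrix (Fin d) (Fin d) ℝ)) ∧
    Tendsto (fun γ : ℝ =>
        ((Aᵀ * Γ₀⁻¹ * A + γ ^ 2 • Chat⁻¹)⁻¹).mulVec
          (Aᵀ.mulVec (Γ₀⁻¹.mulVec y) + γ ^ 2 • Chat⁻¹.mulVec mhat))
      (𝓝[>] 0)
      (𝓝 (((Aᵀ * Γ₀⁻¹ * A)⁻¹).mulVec (Aᵀ.mulVec (Γ₀⁻¹.mulVec y)))) ∧
    (∀ u : Fin d → ℝ,
      ((y - A.mulVec (((Aᵀ * Γ₀⁻¹ * A)⁻¹).mulVec (Aᵀ.mulVec (Γ₀⁻¹.mulVec y)))) ⬝ᵥ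
        Γ₀⁻¹.mulVec (y - A.mulVec (((Aᵀ * Γ₀⁻¹ * A)⁻¹).mulVec (Aᵀ.mulVec (Γ₀⁻¹.mulVec y))))) ≤
      ((y - A.mulVec u) ⬝ᵥ Γ₀⁻¹.mulVec (y - A.mulVec u))) ∧
    (∀ u : Fin d → ℝ,
      ((y - A.mulVec u) ⬝ᵥ Γ₀⁻¹.mulVec (y - A.mulVec u)) =
        ((y - A.mulVec (((Aᵀ * Γ₀⁻¹ * A)⁻¹).mulVec (Aᵀ.mulVec (Γ₀⁻¹.mulVec y)))) ⬝ᵥ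
          Γ₀⁻¹.mulVec (y - A.mulVec (((Aᵀ * Γ₀⁻¹ * A)⁻¹).mulVec (Aᵀ.mulVec (Γ₀⁻¹.mulVec y))))) →
      u = ((Aᵀ * Γ₀⁻¹ * A)⁻¹).mulVec (Aᵀ.mulVec (Γ₀⁻¹.mulVec y))) := by
  have hG : (Γ₀⁻¹).PosDef := hΓ₀.inv
  have hinj : Function.Injective A.mulVec := by
    intro u v h
    have h2 : A.mulVec (u - v) = 0 := by
      rw [Matrix.mulVec_sub]; exact sub_eq_zero.mpr h
    exact sub_eq_zero.mp (hA _ h2)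
  have hM : (Aᵀ * Γ₀⁻¹ * A).PosDef := by
    have := hG.conjTranspose_mul_mul_same hinj
    rwa [Matrix.conjTranspose_eq_transpose_of_trivial] at this
  have hGt : (Γ₀⁻¹)ᵀ = Γ₀⁻¹ := by
    have := hG.isHermitian.eq
    rwa [Matrix.conjTranspose_eq_transpose_of_trivial] at this
  have hdet : (Aᵀ * Γ₀⁻¹ * A).det ≠ 0 := hM.det_pos.ne'
  have hinv : Tendsto (fun γ : ℝ => (Aᵀ * Γ₀⁻¹ * A + γ ^ 2 • Chat⁻¹)⁻¹)
      (𝓝[>] 0) (𝓝 (Aᵀ * Γ₀⁻¹ * A)⁻¹) := by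
    have hc : Continuous (fun γ : ℝ => Aᵀ * Γ₀⁻¹ * A + γ ^ 2 • Chat⁻¹) := by fun_prop
    have h1 : ContinuousAt (fun γ : ℝ => (Aᵀ * Γ₀⁻¹ * A + γ ^ 2 • Chat⁻¹)⁻¹) 0 := by
      generalize Chat⁻¹ = D at hc ⊢
      generalize Aᵀ * Γ₀⁻¹ * A = M at hc hdet ⊢
      simp only [Matrix.inv_def, Ring.inverse_eq_inv']
      refine ContinuousAt.smul (ContinuousAt.inv₀ hc.matrix_det.continuousAt ?_)
        hc.matrix_adjugate.continuousAt
      simpa using hdet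
    have h2 := h1.tendsto
    simp only [ne_eq, OfNat.ofNat_ne_zero, not_false_eq_true, zero_pow, zero_smul, add_zero] at h2
    exact h2.mono_left nhdsWithin_le_nhds
  have hsq : Tendsto (fun γ : ℝ => γ ^ 2) (𝓝[>] 0) (𝓝 0) := by
    have h : Continuous (fun γ : ℝ => γ ^ 2) := by fun_prop
    have h2 := h.tendsto 0
    simp only [ne_eq, OfNat.ofNat_ne_zero, not_false_eq_true, zero_pow] at h2
    exact h2.mono_left nhdsWithin_le_nhds
  set b := Aᵀ.mulVec (Γ₀⁻¹.mulVec y) with hb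
  set m := ((Aᵀ * Γ₀⁻¹ * A)⁻¹).mulVec b with hm
  have hMm : (Aᵀ * Γ₀⁻¹ * A).mulVec m = b := by
    rw [hm, Matrix.mulVec_mulVec, Matrix.mul_nonsing_inv _ (isUnit_iff_ne_zero.mpr hdet),
      Matrix.one_mulVec]
  have hr : Aᵀ.mulVec (Γ₀⁻¹.mulVec (y - A.mulVec m)) = 0 := by
    rw [Matrix.mulVec_sub, Matrix.mulVec_sub, ← hb, Matrix.mulVec_mulVec, Matrix.mulVec_mulVec,
      hMm, sub_self]
  have hcross : ∀ v : Fin d → ℝ, A.mulVec v ⬝ᵥ Γ₀⁻¹.mulVec (y - A.mulVec m) = 0 := by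
    intro v
    rw [dotProduct_comm, Matrix.dotProduct_mulVec, ← Matrix.mulVec_transpose, hr, zero_dotProduct]
  have hcross' : ∀ v : Fin d → ℝ, (y - A.mulVec m) ⬝ᵥ Γ₀⁻¹.mulVec (A.mulVec v) = 0 := by
    intro v
    rw [Matrix.dotProduct_mulVec, ← Matrix.mulVec_transpose, hGt, dotProduct_comm, hcross]
  have key : ∀ u : Fin d → ℝ, (y - A.mulVec u) ⬝ᵥ Γ₀⁻¹.mulVec (y - A.mulVec u) =
      (y - A.mulVec m) ⬝ᵥ Γ₀⁻¹.mulVec (y - A.mulVec m) +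
        A.mulVec (u - m) ⬝ᵥ Γ₀⁻¹.mulVec (A.mulVec (u - m)) := by
    intro u
    have e : y - A.mulVec u = (y - A.mulVec m) - A.mulVec (u - m) := by
      rw [Matrix.mulVec_sub]; abel
    rw [e, Matrix.mulVec_sub Γ₀⁻¹, sub_dotProduct, dotProduct_sub, dotProduct_sub, hcross, hcross']
    ring
  refine ⟨hM, ?_, ?_, ?_, ?_⟩
  · simpa using hsq.smul hinv
  · have h1 : Tendsto (fun γ : ℝ => b + γ ^ 2 • Chat⁻¹.mulVec mhat) (𝓝[>] 0) (𝓝 b) := by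
      simpa using (tendsto_const_nhds (x := b)).add
        (hsq.smul (tendsto_const_nhds (x := Chat⁻¹.mulVec mhat)))
    have hc : Continuous (fun p : Matrix (Fin d) (Fin d) ℝ × (Fin d → ℝ) => p.1.mulVec p.2) :=
      continuous_fst.matrix_mulVec continuous_snd
    exact (hc.tendsto ((Aᵀ * Γ₀⁻¹ * A)⁻¹, b)).comp (hinv.prodMk_nhds h1)
  · intro u
    rw [key u]
    have := hG.posSemidef.dotProduct_mulVec_nonneg (A.mulVec (u - m))
    simp only [star_trivial] at this
    linarith
  · intro u h
    rw [key u] at h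
    by_contra hne
    have hv : A.mulVec (u - m) ≠ 0 := fun h0 => hne (sub_eq_zero.mp (hA _ h0))
    have := hG.dotProduct_mulVec_pos hv
    simp only [star_trivial] at this
    linarith
end

section
/- Let Ĉ ∈ ℝ^{d×d} be symmetric positive definite and let Q = (Q₁ Q₂) ∈ ℝ^{d×d} be an orthogonal matrix with blocks Q₁ ∈ ℝ^{d×k} and Q₂ ∈ ℝ^{d×(d−k)} (so QᵀQ = I_d). Then the matrices Q₁ᵀĈQ₁ and Q₂ᵀĈ⁻¹Q₂ are invertible and the identity I_d = Ĉ·Q₁·(Q₁ᵀĈQ₁)⁻¹·Q₁ᵀ + Q₂·(Q₂ᵀĈ⁻¹Q₂)⁻¹·Q₂ᵀ·Ĉ⁻¹ holds. -/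
open Matrix

/-- decomposition of the identity. If `Ĉ` is symmetric positive
definite and `Q = (Q₁ Q₂)` is orthogonal (expressed blockwise), then
`Q₁ᵀĈQ₁` and `Q₂ᵀĈ⁻¹Q₂` are invertible and
`I = Ĉ Q₁ (Q₁ᵀĈQ₁)⁻¹ Q₁ᵀ + Q₂ (Q₂ᵀĈ⁻¹Q₂)⁻¹ Q₂ᵀ Ĉ⁻¹`. -/
theorem stmt_9 (k l : ℕ)
    (Chat : Matrix (Fin (k + l)) (Fin (k + l)) ℝ) (hChat : Chat.PosDef)
    (Q₁ : Matrix (Fin (k + l)) (Fin k) ℝ) (Q₂ : Matrix (Fin (k + l)) (Fin l) ℝ)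
    (h11 : Q₁ᵀ * Q₁ = 1) (h22 : Q₂ᵀ * Q₂ = 1) (h12 : Q₁ᵀ * Q₂ = 0)
    (hQQ : Q₁ * Q₁ᵀ + Q₂ * Q₂ᵀ = 1) :
    IsUnit (Q₁ᵀ * Chat * Q₁) ∧ IsUnit (Q₂ᵀ * Chat⁻¹ * Q₂) ∧
    (1 : Matrix (Fin (k + l)) (Fin (k + l)) ℝ) =
      Chat * Q₁ * (Q₁ᵀ * Chat * Q₁)⁻¹ * Q₁ᵀ +
        Q₂ * (Q₂ᵀ * Chat⁻¹ * Q₂)⁻¹ * Q₂ᵀ * Chat⁻¹ := by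
  have hA : IsUnit (Q₁ᵀ * Chat * Q₁) := by
    have := hChat.conjTranspose_mul_mul_same (B := Q₁)
      (Function.LeftInverse.injective (g := Q₁ᵀ.mulVec) fun x => by simp [h11])
    rw [conjTranspose_eq_transpose_of_trivial] at this
    exact this.isUnit
  have hB : IsUnit (Q₂ᵀ * Chat⁻¹ * Q₂) := by
    have := hChat.inv.conjTranspose_mul_mul_same (B := Q₂)
      (Function.LeftInverse.injective (g := Q₂ᵀ.mulVec) fun x => by simp [h22])
    rw [conjTranspose_eq_transpose_of_trivial] at this
    exact this.isUnit
  refine ⟨hA, hB, ?_⟩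
  have hA' := (isUnit_iff_isUnit_det _).1 hA
  have hB' := (isUnit_iff_isUnit_det _).1 hB
  have hC' := (isUnit_iff_isUnit_det _).1 hChat.isUnit
  have h21 : Q₂ᵀ * Q₁ = 0 := by
    have := congrArg transpose h12
    simpa using this
  set A := Q₁ᵀ * Chat * Q₁ with hAdef
  set B := Q₂ᵀ * Chat⁻¹ * Q₂ with hBdef
  set P := Chat * Q₁ * A⁻¹ * Q₁ᵀ + Q₂ * B⁻¹ * Q₂ᵀ * Chat⁻¹ with hP
  have hP1 : P * (Chat * Q₁) = Chat * Q₁ := by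
    calc P * (Chat * Q₁) = Chat * Q₁ * (A⁻¹ * A)
          + Q₂ * B⁻¹ * (Q₂ᵀ * ((Chat⁻¹ * Chat) * Q₁)) := by
          simp only [hP, hAdef, Matrix.add_mul, Matrix.mul_assoc]
      _ = Chat * Q₁ := by
          rw [nonsing_inv_mul _ hA', nonsing_inv_mul _ hC', Matrix.one_mul, h21]
          simp
  have hP2 : P * Q₂ = Q₂ := by
    calc P * Q₂ = Chat * Q₁ * A⁻¹ * (Q₁ᵀ * Q₂) + Q₂ * (B⁻¹ * B) := by
          simp only [hP, hBdef, Matrix.add_mul, Matrix.mul_assoc]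
      _ = Q₂ := by
          rw [nonsing_inv_mul _ hB', h12]
          simp
  have hE1 : (1 - P) * Chat * Q₁ = 0 := by
    rw [Matrix.mul_assoc, Matrix.sub_mul, hP1, Matrix.one_mul, sub_self]
  have hE2 : (1 - P) * Q₂ = 0 := by
    rw [Matrix.sub_mul, hP2, Matrix.one_mul, sub_self]
  generalize hE : 1 - P = E at hE1 hE2
  have hEC : E * Chat = E * Chat * Q₂ * Q₂ᵀ := by
    calc E * Chat = E * Chat * (Q₁ * Q₁ᵀ + Q₂ * Q₂ᵀ) := by rw [hQQ, Matrix.mul_one]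
      _ = E * Chat * Q₁ * Q₁ᵀ + E * Chat * Q₂ * Q₂ᵀ := by
          simp only [Matrix.mul_add, Matrix.mul_assoc]
      _ = _ := by rw [hE1, Matrix.zero_mul, zero_add]
  have hE3 : E = E * Chat * Q₂ * Q₂ᵀ * Chat⁻¹ := by
    rw [← hEC, mul_nonsing_inv_cancel_right _ _ hC']
  have hE4 : E * Chat * Q₂ * B = 0 := by
    calc E * Chat * Q₂ * B = (E * Chat * Q₂ * Q₂ᵀ * Chat⁻¹) * Q₂ := by
          simp only [hBdef, Matrix.mul_assoc]
      _ = 0 := by rw [← hE3, hE2]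
  have hE5 : E * Chat * Q₂ = 0 := by
    rw [← mul_nonsing_inv_cancel_right B (E * Chat * Q₂) hB', hE4, Matrix.zero_mul]
  have hE0 : E = 0 := by
    rw [hE3, hE5, Matrix.zero_mul, Matrix.zero_mul]
  exact sub_eq_zero.1 (hE.trans hE0)
end

section
/- Let S = {1,…,d} be a finite state space and p a stochastic matrix on S (p(i,j) ≥ 0, Σ_j p(i,j) = 1) such that ε := min_{i,j∈S} p(i,j) > 0. Then p has a unique invariant probability distribution π (i.e., Σ_i π(i)p(i,j) = π(j) for all j), and for every initial probability distribution π₀ on S the distributions π_n = π₀pⁿ satisfy d_TV(π_n, π) ≤ (1 − ε)ⁿ for all n ≥ 0, where d_TV(μ,ν) = (1/2)Σ_{i∈S}|μ(i) − ν(i)|. -/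
theorem aux_contr {d : ℕ} (hd : 0 < d) (p : Fin d → Fin d → ℝ)
    (hp1 : ∀ i, ∑ j, p i j = 1) (ε : ℝ) (hε : ∀ i j, ε ≤ p i j) (hεpos : 0 < ε)
    (x y : Fin d → ℝ) (hxy : ∑ i, x i = ∑ i, y i) :
    ∑ j, |(∑ i, x i * p i j) - ∑ i, y i * p i j| ≤ (1 - ε) * ∑ j, |x j - y j| := by
  have h1 : ∀ j, |(∑ i, x i * p i j) - ∑ i, y i * p i j| ≤ ∑ i, |x i - y i| * (p i j - ε) := by
    intro j
    have : (∑ i, x i * p i j) - ∑ i, y i * p i j = ∑ i, (x i - y i) * (p i j - ε) := by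
      have h0 : ∑ i, (x i - y i) * ε = 0 := by
        rw [← Finset.sum_mul, Finset.sum_sub_distrib, hxy]; simp
      simp only [mul_sub, Finset.sum_sub_distrib, h0]
      rw [← Finset.sum_sub_distrib, sub_zero]
      exact Finset.sum_congr rfl fun i _ => by ring
    rw [this]
    refine (Finset.abs_sum_le_sum_abs _ _).trans (le_of_eq ?_)
    refine Finset.sum_congr rfl fun i _ => ?_
    rw [abs_mul, abs_of_nonneg (sub_nonneg.2 (hε i j))]
  refine (Finset.sum_le_sum fun j _ => h1 j).trans ?_
  rw [Finset.sum_comm, Finset.mul_sum]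
  refine Finset.sum_le_sum fun i _ => ?_
  rw [← Finset.mul_sum, Finset.sum_sub_distrib, hp1, mul_comm]
  refine mul_le_mul_of_nonneg_right ?_ (abs_nonneg _)
  have : (1 : ℝ) ≤ d := by exact_mod_cast hd
  simp only [Finset.sum_const, Finset.card_univ, Fintype.card_fin, nsmul_eq_mul]
  nlinarith

/-- ergodicity in finite state spaces. If a stochastic matrix `p`
on `S = {1,…,d}` satisfies `ε := min_{i,j} p(i,j) > 0`, then `p` has a unique
invariant probability distribution `π`, and for every initial distribution `π₀`
the laws `π_n = π₀pⁿ` satisfy `d_TV(π_n, π) ≤ (1−ε)ⁿ`. -/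
theorem stmt_14 (d : ℕ) (hd : 0 < d)
    (p : Fin d → Fin d → ℝ)
    (hp0 : ∀ i j, 0 ≤ p i j) (hp1 : ∀ i, ∑ j, p i j = 1)
    (ε : ℝ) (hε : ε = ⨅ i : Fin d, ⨅ j : Fin d, p i j) (hεpos : 0 < ε) :
    ∃ π : Fin d → ℝ,
      ((∀ i, 0 ≤ π i) ∧ (∑ i, π i) = 1 ∧ ∀ j, ∑ i, π i * p i j = π j) ∧
      (∀ π' : Fin d → ℝ,
        ((∀ i, 0 ≤ π' i) ∧ (∑ i, π' i) = 1 ∧ ∀ j, ∑ i, π' i * p i j = π' j) →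
        π' = π) ∧
      (∀ π₀ : Fin d → ℝ, (∀ i, 0 ≤ π₀ i) → (∑ i, π₀ i) = 1 →
        ∀ n : ℕ,
          (1 / 2) * ∑ j, |((fun q : Fin d → ℝ => fun j => ∑ i, q i * p i j)^[n] π₀) j - π j| ≤
            (1 - ε) ^ n) := by
  have hle : ∀ i j, ε ≤ p i j := by
    intro i j
    rw [hε]
    exact (ciInf_le (Set.finite_range _).bddBelow i).trans
      (ciInf_le (Set.finite_range _).bddBelow j)
  have hε1 : 0 ≤ 1 - ε := by
    have i0 : Fin d := ⟨0, hd⟩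
    have h := Finset.single_le_sum (f := fun j => p i0 j) (fun j _ => hp0 i0 j)
      (Finset.mem_univ i0)
    have h2 := hle i0 i0
    rw [hp1] at h
    linarith
  set T : (Fin d → ℝ) → (Fin d → ℝ) := fun q => fun j => ∑ i, q i * p i j with hT
  have hc : ∀ x y : Fin d → ℝ, ∑ i, x i = ∑ i, y i →
      ∑ j, |T x j - T y j| ≤ (1 - ε) * ∑ j, |x j - y j| :=
    fun x y h => aux_contr hd p hp1 ε hle hεpos x y h
  have hTs : ∀ x, ∑ j, T x j = ∑ j, x j := by
    intro x
    simp only [hT]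
    rw [Finset.sum_comm]
    refine Finset.sum_congr rfl fun i _ => ?_
    rw [← Finset.mul_sum, hp1, mul_one]
  have hT0 : ∀ x, (∀ i, 0 ≤ x i) → ∀ i, 0 ≤ T x i := fun x hx j =>
    Finset.sum_nonneg fun i _ => mul_nonneg (hx i) (hp0 i j)
  have hits : ∀ (n : ℕ) x, ∑ j, (T^[n] x) j = ∑ j, x j := by
    intro n
    induction n with
    | zero => intro x; rfl
    | succ n ih => intro x; rw [Function.iterate_succ_apply', hTs, ih]
  have hit0 : ∀ (n : ℕ) x, (∀ i, 0 ≤ x i) → ∀ i, 0 ≤ (T^[n] x) i := by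
    intro n
    induction n with
    | zero => intro x hx; exact hx
    | succ n ih => intro x hx; rw [Function.iterate_succ_apply']; exact hT0 _ (ih x hx)
  have hit : ∀ (n : ℕ) x y, (∀ i, 0 ≤ x i) → ∑ i, x i = 1 → (∀ i, 0 ≤ y i) → ∑ i, y i = 1 →
      ∑ j, |(T^[n] x) j - (T^[n] y) j| ≤ 2 * (1 - ε) ^ n := by
    intro n x y hx hx1 hy hy1
    induction n with
    | zero =>
      have : ∑ j, |x j - y j| ≤ ∑ j, (x j + y j) := Finset.sum_le_sum fun j _ => by
        rw [abs_le]; constructor <;> linarith [hx j, hy j]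
      rw [Finset.sum_add_distrib, hx1, hy1] at this
      simp only [Function.iterate_zero, id, pow_zero]
      linarith
    | succ n ih =>
      rw [Function.iterate_succ_apply', Function.iterate_succ_apply']
      refine (hc _ _ (by rw [hits, hits, hx1, hy1])).trans ?_
      rw [pow_succ]
      nlinarith
  have hTc : Continuous T := by
    simp only [hT]
    fun_prop
  obtain ⟨x, hx, hx1⟩ : ∃ x : Fin d → ℝ, (∀ i, 0 ≤ x i) ∧ ∑ i, x i = 1 :=
    ⟨p ⟨0, hd⟩, hp0 _, hp1 _⟩
  have hcau : CauchySeq fun n => T^[n] x := by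
    refine cauchySeq_of_le_geometric (1 - ε) 2 (by linarith) fun n => ?_
    have h := hit n x (T x) hx hx1 (hT0 x hx) ((hTs x).trans hx1)
    rw [dist_pi_le_iff (by positivity)]
    intro j
    rw [Real.dist_eq, Function.iterate_succ_apply]
    exact (Finset.single_le_sum (f := fun j => |(T^[n] x) j - (T^[n] (T x)) j|)
      (fun j _ => abs_nonneg _) (Finset.mem_univ j)).trans h
  obtain ⟨q, hq⟩ := cauchySeq_tendsto_of_complete hcau
  have hqT : T q = q := isFixedPt_of_tendsto_iterate hq hTc.continuousAt
  have hqj := tendsto_pi_nhds.1 hq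
  have hq0 : ∀ i, 0 ≤ q i := fun i => ge_of_tendsto' (hqj i) fun n => hit0 n x hx i
  have hq1 : ∑ i, q i = 1 := by
    have h := tendsto_finsetSum Finset.univ fun i _ => hqj i
    simp only [hits, hx1] at h
    exact tendsto_nhds_unique h tendsto_const_nhds
  refine ⟨q, ⟨hq0, hq1, fun j => congrFun hqT j⟩, ?_, ?_⟩
  · rintro y ⟨hy0, hy1, hy⟩
    have hyT : T y = y := funext hy
    have h := hc y q (hy1.trans hq1.symm)
    rw [hyT, hqT] at h
    have h0 : 0 ≤ ∑ j, |y j - q j| := Finset.sum_nonneg fun j _ => abs_nonneg _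
    have h2 : ∑ j, |y j - q j| = 0 := by nlinarith
    rw [Finset.sum_eq_zero_iff_of_nonneg fun j _ => abs_nonneg _] at h2
    funext j
    exact sub_eq_zero.1 (abs_eq_zero.1 (h2 j (Finset.mem_univ j)))
  · intro y hy hy1 n
    have h := hit n y q hy hy1 hq0 hq1
    rw [Function.iterate_fixed hqT] at h
    linarith
end

section
/- Let Ψ : ℝ^d → ℝ^d be bounded and continuous, let C₀, Σ₀ ∈ ℝ^{d×d} and Γ ∈ ℝ^{k×k} be symmetric positive definite, H ∈ ℝ^{k×d}, m₀ ∈ ℝ^d, and y₁,…,y_J ∈ ℝ^k. For σ > 0 define J_σ(V) = (1/2)⟨v₀−m₀, C₀⁻¹(v₀−m₀)⟩ + (1/(2σ²))Σ_{j=0}^{J−1}⟨v_{j+1}−Ψ(v_j), Σ₀⁻¹(v_{j+1}−Ψ(v_j))⟩ + (1/2)Σ_{j=0}^{J−1}⟨y_{j+1}−Hv_{j+1}, Γ⁻¹(y_{j+1}−Hv_{j+1})⟩ on ℝ^{d(J+1)}, and for each σ let V^σ be a minimizer of J_σ. Then there exist a sequence σ_n → 0 and V* ∈ ℝ^{d(J+1)}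 such that V^{σ_n} → V* and V* satisfies the hard constraint v*_{j+1} = Ψ(v*_j) for j = 0,…,J−1. -/
open Matrix Filter Topology

theorem coercive_aux {n : ℕ} (A : Matrix (Fin n) (Fin n) ℝ) (hA : A.PosDef) :
    ∃ c : ℝ, 0 < c ∧ ∀ x : Fin n → ℝ, c * ‖x‖ ^ 2 ≤ x ⬝ᵥ A.mulVec x := by
  have hpos : ∀ x : Fin n → ℝ, x ≠ 0 → 0 < x ⬝ᵥ A.mulVec x := by
    intro x hx
    simpa using hA.dotProduct_mulVec_pos hx
  have hcont : Continuous fun x : Fin n → ℝ => x ⬝ᵥ A.mulVec x := by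
    fun_prop
  rcases (Metric.sphere (0 : Fin n → ℝ) 1).eq_empty_or_nonempty with he | hne
  · refine ⟨1, one_pos, fun x => ?_⟩
    by_cases hx : x = 0
    · simp [hx]
    · exfalso
      have : (‖x‖⁻¹ • x) ∈ Metric.sphere (0 : Fin n → ℝ) 1 := by
        simp [norm_smul, hx]
      rw [he] at this
      exact this
  · obtain ⟨z, hz, hmin⟩ := (isCompact_sphere (0 : Fin n → ℝ) 1).exists_isMinOn hne
      hcont.continuousOn
    have hz0 : z ≠ 0 := by
      rintro rfl
      simp at hz
    refine ⟨z ⬝ᵥ A.mulVec z, hpos z hz0, fun x => ?_⟩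
    by_cases hx : x = 0
    · simp [hx]
    · have hm : (‖x‖⁻¹ • x) ∈ Metric.sphere (0 : Fin n → ℝ) 1 := by
        simp [norm_smul, hx]
      have h := hmin hm
      simp only [Set.mem_setOf_eq, Matrix.mulVec_smul, smul_dotProduct, dotProduct_smul,
        smul_eq_mul] at h
      have hn : 0 < ‖x‖ := norm_pos_iff.mpr hx
      calc _ ≤ (‖x‖⁻¹ * (‖x‖⁻¹ * (x ⬝ᵥ A.mulVec x))) * ‖x‖ ^ 2 := by gcongr
        _ = _ := by field_simp

theorem le_of_sq_aux {c t B : ℝ} (hc : 0 < c) (h : c * t ^ 2 ≤ B) : t ≤ B / c + 1 := by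
  have : t ^ 2 ≤ B / c := by rw [le_div_iff₀ hc]; linarith
  nlinarith [sq_nonneg (t - 1)]

/-- small signal noise limit of weak-constraint 4DVAR. If `V^σ`
minimizes the objective `J_σ` (with dynamics noise covariance `σ²Σ₀`), then
there is a sequence `σ_n → 0` along which `V^{σ_n}` converges to a limit `V*`
satisfying the hard constraint `v*_{j+1} = Ψ(v*_j)`. -/
theorem stmt_18 (d k J : ℕ)
    (Ψ : (Fin d → ℝ) → (Fin d → ℝ)) (hΨc : Continuous Ψ)
    (hΨb : ∃ R : ℝ, ∀ v, ‖Ψ v‖ ≤ R)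
    (C₀ Sig₀ : Matrix (Fin d) (Fin d) ℝ) (Γ : Matrix (Fin k) (Fin k) ℝ)
    (hC₀ : C₀.PosDef) (hSig₀ : Sig₀.PosDef) (hΓ : Γ.PosDef)
    (H : Matrix (Fin k) (Fin d) ℝ) (m₀ : Fin d → ℝ)
    (y : Fin J → (Fin k → ℝ))
    (Jσ : ℝ → (Fin (J + 1) → (Fin d → ℝ)) → ℝ)
    (hJσ : ∀ (σ : ℝ) (V : Fin (J + 1) → (Fin d → ℝ)),
      Jσ σ V = (1 / 2) * ((V 0 - m₀) ⬝ᵥ C₀⁻¹.mulVec (V 0 - m₀)) +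
        (1 / (2 * σ ^ 2)) * ∑ j : Fin J,
          ((V j.succ - Ψ (V j.castSucc)) ⬝ᵥ
            Sig₀⁻¹.mulVec (V j.succ - Ψ (V j.castSucc))) +
        (1 / 2) * ∑ j : Fin J,
          ((y j - H.mulVec (V j.succ)) ⬝ᵥ
            Γ⁻¹.mulVec (y j - H.mulVec (V j.succ))))
    (Vm : ℝ → (Fin (J + 1) → (Fin d → ℝ)))
    (hVm : ∀ σ : ℝ, 0 < σ → ∀ W : Fin (J + 1) → (Fin d → ℝ), Jσ σ (Vm σ) ≤ Jσ σ W) :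
    ∃ (σn : ℕ → ℝ) (Vstar : Fin (J + 1) → (Fin d → ℝ)),
      (∀ n, 0 < σn n) ∧
      Tendsto σn atTop (𝓝 0) ∧
      Tendsto (fun n => Vm (σn n)) atTop (𝓝 Vstar) ∧
      ∀ j : Fin J, Vstar j.succ = Ψ (Vstar j.castSucc) := by
  obtain ⟨R, hR⟩ := hΨb
  obtain ⟨c, hc, hcC⟩ := coercive_aux _ hC₀.inv
  obtain ⟨s, hs, hsS⟩ := coercive_aux _ hSig₀.inv
  obtain ⟨g, hg, hgG⟩ := coercive_aux _ hΓ.inv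
  set W : Fin (J + 1) → (Fin d → ℝ) := fun i => Ψ^[(i : ℕ)] m₀ with hW
  have hWs : ∀ j : Fin J, W j.succ = Ψ (W j.castSucc) := by
    intro j
    simp [hW, Function.iterate_succ_apply']
  obtain ⟨M, hM⟩ : ∃ M : ℝ, ∀ σ, Jσ σ W = M :=
    ⟨Jσ 0 W, fun σ => by rw [hJσ, hJσ]; simp [hWs]⟩
  have key : ∀ σ : ℝ, 0 < σ → c * ‖Vm σ 0 - m₀‖ ^ 2 ≤ 2 * M ∧
      ∀ j : Fin J, s * ‖Vm σ j.succ - Ψ (Vm σ j.castSucc)‖ ^ 2 ≤ σ ^ 2 * (2 * M) := by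
    intro σ hσ
    have h := hVm σ hσ W
    rw [hM, hJσ] at h
    have h1 := hcC (Vm σ 0 - m₀)
    have hq : ∀ j : Fin J, 0 ≤ (Vm σ j.succ - Ψ (Vm σ j.castSucc)) ⬝ᵥ
            Sig₀⁻¹.mulVec (Vm σ j.succ - Ψ (Vm σ j.castSucc)) :=
      fun j => le_trans (by positivity) (hsS _)
    have h3 : 0 ≤ ∑ j : Fin J,
          ((y j - H.mulVec (Vm σ j.succ)) ⬝ᵥ
            Γ⁻¹.mulVec (y j - H.mulVec (Vm σ j.succ))) :=
      Finset.sum_nonneg fun j _ => le_trans (by positivity) (hgG _)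
    have h2 := Finset.sum_nonneg fun j (_ : j ∈ Finset.univ) => hq j
    have h4 : 0 ≤ c * ‖Vm σ 0 - m₀‖ ^ 2 := by positivity
    have hle : ∀ j : Fin J, _ := fun j =>
      Finset.single_le_sum (fun j (_ : j ∈ Finset.univ) => hq j) (Finset.mem_univ j)
    set S := ∑ j : Fin J, (Vm σ j.succ - Ψ (Vm σ j.castSucc)) ⬝ᵥ
            Sig₀⁻¹.mulVec (Vm σ j.succ - Ψ (Vm σ j.castSucc)) with hS
    have h5 : 0 ≤ 1 / (2 * σ ^ 2) * S := by positivity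
    refine ⟨by linarith, fun j => ?_⟩
    have h6 : 1 / (2 * σ ^ 2) * S ≤ M := by linarith
    have h7 : S ≤ σ ^ 2 * (2 * M) := by
      calc S = (2 * σ ^ 2) * (1 / (2 * σ ^ 2) * S) := by field_simp
        _ ≤ (2 * σ ^ 2) * M := by gcongr
        _ = _ := by ring
    exact (hsS _).trans ((hle j).trans h7)
  have hM0 : 0 ≤ M := by
    have := (key 1 one_pos).1
    have h4 : 0 ≤ c * ‖Vm 1 0 - m₀‖ ^ 2 := by positivity
    linarith
  have hR0 : 0 ≤ R := (norm_nonneg _).trans (hR 0)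
  let τ : ℕ → ℝ := fun n => 1 / ((n : ℝ) + 1)
  have hτ0 : ∀ n, 0 < τ n := fun n => by positivity
  have hτ1 : ∀ n, τ n ≤ 1 := fun n => by
    simp only [τ]
    rw [div_le_one (by positivity)]
    have : (0 : ℝ) ≤ n := by positivity
    linarith
  have hτt : Tendsto τ atTop (𝓝 0) := tendsto_one_div_add_atTop_nhds_zero_nat
  set B : ℝ := (2 * M / c + 1 + ‖m₀‖) + (2 * M / s + 1 + R) with hB
  have hB1 : 0 ≤ 2 * M / c + 1 + ‖m₀‖ := by positivity
  have hB2 : 0 ≤ 2 * M / s + 1 + R := by positivity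
  have hbd : ∀ n, Vm (τ n) ∈ Metric.closedBall (0 : Fin (J + 1) → (Fin d → ℝ)) B := by
    intro n
    rw [mem_closedBall_zero_iff, pi_norm_le_iff_of_nonneg (by linarith)]
    obtain ⟨k1, k2⟩ := key _ (hτ0 n)
    intro i
    refine Fin.cases ?_ (fun j => ?_) i
    · have := le_of_sq_aux hc k1
      have h := norm_sub_norm_le (Vm (τ n) 0) m₀
      linarith
    · have hsq : τ n ^ 2 * (2 * M) ≤ 2 * M := by
        have : τ n ^ 2 ≤ 1 := pow_le_one₀ (hτ0 n).le (hτ1 n)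
        nlinarith
      have := le_of_sq_aux hs ((k2 j).trans hsq)
      have h := norm_sub_norm_le (Vm (τ n) j.succ) (Ψ (Vm (τ n) j.castSucc))
      have := hR (Vm (τ n) j.castSucc)
      linarith
  obtain ⟨V, -, φ, hφ, hlim⟩ := (isCompact_closedBall _ _).tendsto_subseq hbd
  have hτφ : Tendsto (fun n => τ (φ n)) atTop (𝓝 0) := hτt.comp hφ.tendsto_atTop
  refine ⟨fun n => τ (φ n), V, fun n => hτ0 _, hτφ, hlim, fun j => ?_⟩
  have hp := tendsto_pi_nhds.mp hlim
  have l1 : Tendsto (fun n => s * ‖Vm (τ (φ n)) j.succ - Ψ (Vm (τ (φ n)) j.castSucc)‖ ^ 2)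
      atTop (𝓝 (s * ‖V j.succ - Ψ (V j.castSucc)‖ ^ 2)) :=
    ((((hp j.succ).sub ((hΨc.tendsto _).comp (hp j.castSucc))).norm).pow 2).const_mul s
  have l2 : Tendsto (fun n => τ (φ n) ^ 2 * (2 * M)) atTop (𝓝 0) := by
    simpa using (hτφ.pow 2).mul_const (2 * M)
  have hfin := le_of_tendsto_of_tendsto' l1 l2 (fun n => (key _ (hτ0 _)).2 j)
  have hz : ‖V j.succ - Ψ (V j.castSucc)‖ ^ 2 = 0 := by
    apply le_antisymm _ (sq_nonneg _)
    by_contra! hcon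
    nlinarith [mul_pos hs hcon]
  exact sub_eq_zero.mp (norm_eq_zero.mp (pow_eq_zero_iff two_ne_zero |>.mp hz))
end

section
/- Let G : ℝ^d → ℝ^k, let Γ ∈ ℝ^{k×k} be symmetric positive definite, let N ≥ 1, and let initial ensemble members u₀^{(1)},…,u₀^{(N)} ∈ ℝ^d and data vectors y_{j+1}^{(n)} ∈ ℝ^k be given. Define the ensemble Kalman inversion iteration: ū_{j+1} = (1/N)Σ_{n=1}^N u_j^{(n)}, Ḡ_j = (1/N)Σ_{n=1}^N G(u_j^{(n)}), C^{uw}_{j+1} = (1/N)Σ_{n=1}^N (u_j^{(n)} − ū_{j+1})⊗(G(u_j^{(n)}) − Ḡ_j), C^{ww}_{j+1} = (1/N)Σ_{n=1}^N (G(u_j^{(n)}) − Ḡ_j)⊗(G(u_j^{(n)}) − Ḡ_j), and u_{j+1}^{(n)} = u_j^{(n)} + C^{uw}_{j+1}(C^{ww}_{j+1} + Γ)⁻¹(y_{j+1}^{(n)} − G(u_j^{(n)})). Let A = Span{u₀^{(n)} : n = 1,…,N}. Then for all j ≥ 0 and all 1 ≤ n ≤ N, u_j^{(n)} ∈ A.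 -/
open Matrix

/-- invariant subspace property of ensemble Kalman inversion.
The EKI iterates
`u_{j+1}⁽ⁿ⁾ = u_j⁽ⁿ⁾ + C^{uw}_{j+1}(C^{ww}_{j+1} + Γ)⁻¹(y_{j+1}⁽ⁿ⁾ − G(u_j⁽ⁿ⁾))`
remain in the linear span of the initial ensemble. -/
theorem stmt_19 (d k N : ℕ) (hN : 0 < N)
    (G : (Fin d → ℝ) → (Fin k → ℝ))
    (Γ : Matrix (Fin k) (Fin k) ℝ) (hΓ : Γ.PosDef)
    (y : ℕ → Fin N → (Fin k → ℝ))
    (u : ℕ → Fin N → (Fin d → ℝ))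
    (ubar : ℕ → (Fin d → ℝ)) (Gbar : ℕ → (Fin k → ℝ))
    (Cuw : ℕ → Matrix (Fin d) (Fin k) ℝ) (Cww : ℕ → Matrix (Fin k) (Fin k) ℝ)
    (hubar : ∀ j, ubar j = (N : ℝ)⁻¹ • ∑ n, u j n)
    (hGbar : ∀ j, Gbar j = (N : ℝ)⁻¹ • ∑ n, G (u j n))
    (hCuw : ∀ j, Cuw j =
      (N : ℝ)⁻¹ • ∑ n, vecMulVec (u j n - ubar j) (G (u j n) - Gbar j))
    (hCww : ∀ j, Cww j =
      (N : ℝ)⁻¹ • ∑ n, vecMulVec (G (u j n) - Gbar j) (G (u j n) - Gbar j))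
    (hupd : ∀ (j : ℕ) (n : Fin N),
      u (j + 1) n = u j n +
        (Cuw j * (Cww j + Γ)⁻¹).mulVec (y (j + 1) n - G (u j n))) :
    ∀ (j : ℕ) (n : Fin N),
      u j n ∈ Submodule.span ℝ (Set.range (u 0)) := by
  intro j
  induction j with
  | zero => exact fun n => Submodule.subset_span ⟨n, rfl⟩
  | succ j ih =>
    intro n
    have hb : ubar j ∈ Submodule.span ℝ (Set.range (u 0)) := by
      rw [hubar]
      exact Submodule.smul_mem _ _ (Submodule.sum_mem _ fun m _ => ih m)
    rw [hupd, ← Matrix.mulVec_mulVec]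
    refine Submodule.add_mem _ (ih n) ?_
    generalize (Cww j + Γ)⁻¹.mulVec (y (j + 1) n - G (u j n)) = v
    rw [hCuw, Matrix.smul_mulVec, Matrix.sum_mulVec]
    refine Submodule.smul_mem _ _ (Submodule.sum_mem _ fun m _ => ?_)
    have h : (vecMulVec (u j m - ubar j) (G (u j m) - Gbar j)).mulVec v
        = ((G (u j m) - Gbar j) ⬝ᵥ v) • (u j m - ubar j) := by
      rw [Matrix.vecMulVec_mulVec]
      ext i
      simp [mul_comm]
    rw [h]
    exact Submodule.smul_mem _ _ (Submodule.sub_mem _ (ih m) hb)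
end
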